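/- Let d ≥ 0. (i) If a global solution w of equation (E) with w(0) = a, w'(0) = 0 satisfies |w(r)| ≤ C_d (1+r)^{-d} on [0,∞) for some C_d > 0, then there exists C'_d > 0, depending continuously on C_d (for fixed N, p, q, α, d), such that |w'(r)| ≤ C'_d (1+r)^{-d-1} on [0,∞). (ii) For any solution w of (E) on some interval [r₀,∞) such that w(r) = O(r^{-d}) as r → ∞, one has w'(r) = O(r^{-d-1}) as r → ∞. -/

import Mathlib

open Set Filter Topology Asymptotics

/-- The p-Laplacian nonlinearity φ_p(x) = |x|^{p-2} x. -/
noncomputable def phiP (p x : ℝ) : ℝ := |x| ^ (p - 2) * x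

/-- `w` is a solution of equation (E) on the interval `I ⊆ (0,∞)`:
`w` is C¹ on `I`, `|w'|^{p-2} w'` is C¹ on `I`, and the equation
`(|w'|^{p-2}w')' + ((N-1)/r)|w'|^{p-2}w' + r w' + α w + |w|^{q-1} w = 0`
holds on `I` (derivatives taken within `I`). -/
def IsSolutionOn (N : ℕ) (p q α : ℝ) (w : ℝ → ℝ) (I : Set ℝ) : Prop :=
  ContDiffOn ℝ 1 w I ∧
  ContDiffOn ℝ 1 (fun r => phiP p (derivWithin w I r)) I ∧
  ∀ r ∈ I,
    derivWithin (fun s => phiP p (derivWithin w I s)) I r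
      + ((N : ℝ) - 1) / r * phiP p (derivWithin w I r)
      + r * derivWithin w I r + α * w r + |w r| ^ (q - 1) * w r = 0

/-- `w` is the global solution of (E) on `[0,∞)` with `w(0) = a`, `w'(0) = 0`:
`w ∈ C¹([0,∞))`, `|w'|^{p-2}w' ∈ C¹([0,∞))`, and (E) holds on `(0,∞)`. -/
def IsGlobalSolution (N : ℕ) (p q α a : ℝ) (w : ℝ → ℝ) : Prop :=
  ContDiffOn ℝ 1 w (Ici 0) ∧
  ContDiffOn ℝ 1 (fun r => phiP p (derivWithin w (Ici 0) r)) (Ici 0) ∧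
  (∀ r ∈ Ioi (0 : ℝ),
    derivWithin (fun s => phiP p (derivWithin w (Ici 0) s)) (Ici 0) r
      + ((N : ℝ) - 1) / r * phiP p (derivWithin w (Ici 0) r)
      + r * derivWithin w (Ici 0) r + α * w r + |w r| ^ (q - 1) * w r = 0) ∧
  w 0 = a ∧ derivWithin w (Ici 0) 0 = 0

/-- `r` is an isolated zero of `w` relative to the set `I`. -/
def IsIsolatedZeroOn (w : ℝ → ℝ) (I : Set ℝ) (r : ℝ) : Prop :=
  r ∈ I ∧ w r = 0 ∧ ∀ᶠ s in 𝓝[I \ {r}] r, w s ≠ 0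

/-- `w` has at least `n` isolated zeros in `(0,∞)`. -/
def HasAtLeastIsolatedZeros (w : ℝ → ℝ) (n : ℕ) : Prop :=
  ∃ z : Fin n → ℝ, StrictMono z ∧ ∀ i, 0 < z i ∧ IsIsolatedZeroOn w (Ici 0) (z i)

/-- Pointwise form of equation (E) at `s`, with `g` in the role of the derivative of `w`. -/
def SolvesAt (N : ℕ) (p q α : ℝ) (w g : ℝ → ℝ) (s : ℝ) : Prop :=
  HasDerivAt w (g s) s ∧
  HasDerivAt (fun r => phiP p (g r))
    (-(((N : ℝ) - 1) / s * phiP p (g s)) - s * g s - α * w s - |w s| ^ (q - 1) * w s) s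

lemma phiP_of_pos {p x : ℝ} (hx : 0 < x) : phiP p x = x ^ (p - 1) := by
  rw [phiP, abs_of_pos hx, ← Real.rpow_add_one hx.ne']
  ring_nf

lemma phiP_zero (p : ℝ) : phiP p 0 = 0 := by simp [phiP]

lemma phiP_neg (p x : ℝ) : phiP p (-x) = -phiP p x := by simp [phiP]

lemma phiP_strictMono {p : ℝ} (hp : 1 < p) : StrictMono (phiP p) := by
  refine strictMono_of_odd_strictMonoOn_nonneg (phiP_neg p) ?_
  intro x hx y hy hxy
  have hy' : 0 < y := lt_of_le_of_lt hx hxy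
  rcases eq_or_lt_of_le (show 0 ≤ x from hx) with h | h
  · rw [← h, phiP_zero, phiP_of_pos hy']
    positivity
  · rw [phiP_of_pos h, phiP_of_pos hy']
    exact Real.rpow_lt_rpow h.le hxy (by linarith)

lemma phiP_pos {p x : ℝ} (hp : 1 < p) (hx : 0 < x) : 0 < phiP p x := by
  simpa [phiP_zero] using phiP_strictMono hp hx

lemma phiP_rpow_one_div {p x : ℝ} (hp : 1 < p) (hx : 0 < x) :
    phiP p (x ^ (1 / (p - 1))) = x := by
  rw [phiP_of_pos (by positivity), ← Real.rpow_mul hx.le, one_div,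
    inv_mul_cancel₀ (by linarith), Real.rpow_one]

lemma SolvesAt.neg {N : ℕ} {p q α : ℝ} {w g : ℝ → ℝ} {s : ℝ} (h : SolvesAt N p q α w g s) :
    SolvesAt N p q α (fun r => -w r) (fun r => -g r) s := by
  refine ⟨h.1.fun_neg, ?_⟩
  have := h.2.fun_neg
  simp only [phiP_neg, abs_neg]
  refine this.congr_deriv ?_
  ring

lemma SolvesAt.of_derivWithin {N : ℕ} {p q α : ℝ} {w : ℝ → ℝ} {r₀ s : ℝ} (hs : r₀ < s)
    (hw : ContDiffOn ℝ 1 w (Ici r₀))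
    (hv : ContDiffOn ℝ 1 (fun r => phiP p (derivWithin w (Ici r₀) r)) (Ici r₀))
    (he : derivWithin (fun s => phiP p (derivWithin w (Ici r₀) s)) (Ici r₀) s
      + ((N : ℝ) - 1) / s * phiP p (derivWithin w (Ici r₀) s)
      + s * derivWithin w (Ici r₀) s + α * w s + |w s| ^ (q - 1) * w s = 0) :
    SolvesAt N p q α w (derivWithin w (Ici r₀)) s := by
  have hn : Ici r₀ ∈ 𝓝 s := Ici_mem_nhds hs
  refine ⟨(hw.differentiableOn one_ne_zero s hs.le).hasDerivWithinAt.hasDerivAt hn, ?_⟩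
  refine ((hv.differentiableOn one_ne_zero s hs.le).hasDerivWithinAt.hasDerivAt hn).congr_deriv ?_
  linarith

lemma abs_source_le {q α x D : ℝ} (hq : 1 < q) (hα : 0 < α) (hx : |x| ≤ D) :
    |α * x + |x| ^ (q - 1) * x| ≤ (α + D ^ (q - 1)) * D := by
  have h0 : 0 ≤ |x| ^ (q - 1) := by positivity
  have hD : 0 ≤ D := (abs_nonneg x).trans hx
  rw [← add_mul, abs_mul, abs_of_nonneg (by positivity)]
  have : |x| ^ (q - 1) ≤ D ^ (q - 1) := Real.rpow_le_rpow (abs_nonneg x) hx (by linarith)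
  gcongr

/-- Upper barrier for `phiP p g`. -/
lemma SolvesAt.phiP_le_barrier {N : ℕ} {p q α : ℝ} {w g : ℝ → ℝ} {a b k c : ℝ}
    (h : ∀ s ∈ Icc a b, SolvesAt N p q α w g s) (ha : phiP p (g a) ≤ c + k * a)
    (hb : ∀ s ∈ Icc a b, phiP p (g s) = c + k * s →
      -(((N : ℝ) - 1) / s * phiP p (g s)) - s * g s - α * w s - |w s| ^ (q - 1) * w s < k)
    (hab : a ≤ b) : phiP p (g b) ≤ c + k * b := by
  refine image_le_of_deriv_right_lt_deriv_boundary (f := fun s => phiP p (g s))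
    (B := fun s => c + k * s) (B' := fun _ => k)
    (fun s hs => (h s hs).2.continuousAt.continuousWithinAt)
    (fun s hs => (h s (Ico_subset_Icc_self hs)).2.hasDerivWithinAt) ha
    (fun s => ?_) (fun s hs => hb s (Ico_subset_Icc_self hs)) (right_mem_Icc.2 hab)
  simpa using ((hasDerivAt_id s).const_mul k).const_add c

lemma SolvesAt.le_of_bound {N : ℕ} (hN : 1 ≤ N) {p q α : ℝ} (hp : 1 < p) (hq : 1 < q)
    (hα : 0 < α) {w g : ℝ → ℝ} {r D C : ℝ} (hr : 0 < r) (hD : 0 < D)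
    (hDC : D ≤ C) (h : ∀ s ∈ Icc (r / 2) r, SolvesAt N p q α w g s)
    (hw : ∀ s ∈ Icc (r / 2) r, |w s| ≤ D) :
    g r ≤ (5 + 2 * α + 2 * C ^ (q - 1)) * D / r := by
  have hC : 0 < C := hD.trans_le hDC
  have hCq : 0 < C ^ (q - 1) := by positivity
  set A := (5 + 2 * α + 2 * C ^ (q - 1)) * D / r with hA
  have hAr : A * r = (5 + 2 * α + 2 * C ^ (q - 1)) * D := by rw [hA]; field_simp
  have hA0 : 0 < A := by positivity
  have hN' : (0 : ℝ) ≤ (N : ℝ) - 1 := by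
    have : (1 : ℝ) ≤ N := by exact_mod_cast hN
    linarith
  obtain ⟨ξ, hξ, hξe⟩ := exists_hasDerivAt_eq_slope w g (show r / 2 < r by linarith)
    (fun s hs => (h s hs).1.continuousAt.continuousWithinAt)
    (fun s hs => (h s (Ioo_subset_Icc_self hs)).1)
  have hgξ : g ξ ≤ A := by
    rw [hξe, div_le_iff₀ (by linarith)]
    have h1 := abs_le.1 (hw r ⟨by linarith, le_rfl⟩)
    have h2 := abs_le.1 (hw (r / 2) ⟨le_rfl, by linarith⟩)
    have : 0 < (α + C ^ (q - 1)) * D := by positivity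
    nlinarith
  have hsub : Icc ξ r ⊆ Icc (r / 2) r := Icc_subset_Icc_left hξ.1.le
  have key := SolvesAt.phiP_le_barrier (k := 0) (c := phiP p A) (fun s hs => h s (hsub hs))
    (by simpa using (phiP_strictMono hp).monotone hgξ) ?_ hξ.2.le
  · exact (phiP_strictMono hp).le_iff_le.1 (by simpa using key)
  · intro s hs hse
    have hgs : g s = A := (phiP_strictMono hp).injective (by simpa using hse)
    have hs2 := (hsub hs).1
    have hs0 : 0 < s := by linarith
    have h1 := neg_le_of_abs_le (abs_source_le hq hα (hw s (hsub hs)))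
    have h3 : D ^ (q - 1) ≤ C ^ (q - 1) := Real.rpow_le_rpow hD.le hDC (by linarith)
    have h4 : (α + D ^ (q - 1)) * D ≤ (α + C ^ (q - 1)) * D := by gcongr
    have h5 : 0 ≤ ((N : ℝ) - 1) / s * phiP p A :=
      mul_nonneg (div_nonneg hN' hs0.le) (phiP_pos hp hA0).le
    have h6 : r / 2 * A ≤ s * A := by gcongr
    rw [hgs]
    nlinarith

/-- Interior gradient estimate on `[r/2, r]`. -/
lemma SolvesAt.abs_le_of_bound {N : ℕ} (hN : 1 ≤ N) {p q α : ℝ} (hp : 1 < p) (hq : 1 < q)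
    (hα : 0 < α) {w g : ℝ → ℝ} {r D C : ℝ} (hr : 0 < r) (hD : 0 < D)
    (hDC : D ≤ C) (h : ∀ s ∈ Icc (r / 2) r, SolvesAt N p q α w g s)
    (hw : ∀ s ∈ Icc (r / 2) r, |w s| ≤ D) :
    |g r| ≤ (5 + 2 * α + 2 * C ^ (q - 1)) * D / r := by
  refine abs_le'.2 ⟨SolvesAt.le_of_bound hN hp hq hα hr hD hDC h hw, ?_⟩
  exact SolvesAt.le_of_bound hN hp hq hα hr hD hDC (fun s hs => (h s hs).neg)
    (fun s hs => by simpa using hw s hs)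

lemma SolvesAt.le_near_zero {N : ℕ} (hN : 1 ≤ N) {p q α : ℝ} (hp : 1 < p) (hq : 1 < q)
    (hα : 0 < α) {w g : ℝ → ℝ} {a r C : ℝ} (ha : 0 < a) (har : a ≤ r) (hr : r ≤ 1) (hC : 0 < C)
    (h : ∀ s ∈ Icc a r, SolvesAt N p q α w g s) (hw : ∀ s ∈ Icc a r, |w s| ≤ C)
    (hga : phiP p (g a) ≤ 1) :
    g r ≤ (1 + (α + C ^ (q - 1)) * C) ^ (1 / (p - 1)) := by
  set K := (α + C ^ (q - 1)) * C with hK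
  have hK0 : 0 < K := by positivity
  have hN' : (0 : ℝ) ≤ (N : ℝ) - 1 := by
    have : (1 : ℝ) ≤ N := by exact_mod_cast hN
    linarith
  rw [← (phiP_strictMono hp).le_iff_le, phiP_rpow_one_div hp (by positivity)]
  have key := SolvesAt.phiP_le_barrier (k := K) (c := 1) h (by nlinarith) ?_ har
  · nlinarith
  · intro s hs hse
    have hs0 : 0 < s := ha.trans_le hs.1
    have hv : 0 < phiP p (g s) := by rw [hse]; positivity
    have hg : 0 < g s := by rwa [← (phiP_strictMono hp).lt_iff_lt, phiP_zero]
    have h1 := neg_le_of_abs_le (abs_source_le hq hα (hw s hs))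
    have h5 : 0 ≤ ((N : ℝ) - 1) / s * phiP p (g s) := mul_nonneg (div_nonneg hN' hs0.le) hv.le
    have h6 : 0 < s * g s := by positivity
    linarith

lemma SolvesAt.abs_le_near_zero {N : ℕ} (hN : 1 ≤ N) {p q α : ℝ} (hp : 1 < p) (hq : 1 < q)
    (hα : 0 < α) {w g : ℝ → ℝ} {a r C : ℝ} (ha : 0 < a) (har : a ≤ r) (hr : r ≤ 1) (hC : 0 < C)
    (h : ∀ s ∈ Icc a r, SolvesAt N p q α w g s) (hw : ∀ s ∈ Icc a r, |w s| ≤ C)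
    (hga : |phiP p (g a)| ≤ 1) :
    |g r| ≤ (1 + (α + C ^ (q - 1)) * C) ^ (1 / (p - 1)) := by
  have hga' := abs_le.1 hga
  refine abs_le'.2 ⟨SolvesAt.le_near_zero hN hp hq hα ha har hr hC h hw hga'.2, ?_⟩
  exact SolvesAt.le_near_zero (w := fun r => -w r) (g := fun r => -g r) hN hp hq hα ha har hr hC
    (fun s hs => (h s hs).neg) (fun s hs => by simpa using hw s hs)
    (by rw [phiP_neg]; linarith)

/-- Explicit gradient bound as a function of the decay constant. -/
noncomputable def gradBound (p q α d C : ℝ) : ℝ :=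
  2 * ((5 + 2 * α + 2 * (C * 2 ^ d) ^ (q - 1)) * (C * 2 ^ d))
    + (1 + (α + C ^ (q - 1)) * C) ^ (1 / (p - 1)) * 2 ^ (d + 1)

lemma continuousOn_gradBound {p q α d : ℝ} (hα : 0 < α) :
    ContinuousOn (gradBound p q α d) (Ioi 0) := by
  unfold gradBound
  have h1 : ContinuousOn (fun C : ℝ => (C * 2 ^ d) ^ (q - 1)) (Ioi 0) :=
    (by fun_prop : ContinuousOn (fun C : ℝ => C * 2 ^ d) (Ioi 0)).rpow_const
      fun C hC => Or.inl (by have : (0 : ℝ) < C := hC; positivity)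
  have h2 : ContinuousOn (fun C : ℝ => C ^ (q - 1)) (Ioi 0) :=
    continuousOn_id.rpow_const fun C hC => Or.inl (ne_of_gt hC)
  have h3 : ContinuousOn (fun C : ℝ => (1 + (α + C ^ (q - 1)) * C) ^ (1 / (p - 1))) (Ioi 0) :=
    (by fun_prop : ContinuousOn (fun C : ℝ => 1 + (α + C ^ (q - 1)) * C) (Ioi 0)).rpow_const
      fun C hC => Or.inl (by have : (0 : ℝ) < C := hC; positivity)
  fun_prop

lemma rpow_neg_half_le {d x y : ℝ} (hd : 0 ≤ d) (hx : 0 < x) (hy : x / 2 ≤ y) :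
    y ^ (-d) ≤ 2 ^ d * x ^ (-d) := by
  calc y ^ (-d) ≤ (x / 2) ^ (-d) :=
        Real.rpow_le_rpow_of_nonpos (by linarith) hy (by linarith)
    _ = 2 ^ d * x ^ (-d) := by
        rw [Real.div_rpow hx.le (by norm_num), Real.rpow_neg (by norm_num : (0 : ℝ) ≤ 2)]
        field_simp

lemma IsGlobalSolution.abs_derivWithin_le {N : ℕ} (hN : 1 ≤ N) {p q α : ℝ} (hp : 1 < p)
    (hq : 1 < q) (hα : 0 < α) {d : ℝ} (hd : 0 ≤ d) {C a : ℝ} (hC : 0 < C) {w : ℝ → ℝ}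
    (hs : IsGlobalSolution N p q α a w) (hw : ∀ r ∈ Ici (0 : ℝ), |w r| ≤ C * (1 + r) ^ (-d))
    {r : ℝ} (hr : 0 ≤ r) :
    |derivWithin w (Ici 0) r| ≤ gradBound p q α d C * (1 + r) ^ (-d - 1) := by
  obtain ⟨hc, hv, he, -, h0⟩ := hs
  have hsol : ∀ s, 0 < s → SolvesAt N p q α w (derivWithin w (Ici 0)) s := fun s hs =>
    SolvesAt.of_derivWithin hs hc hv (he s hs)
  have hpos : 0 < (1 + r) ^ (-d - 1) := by positivity
  have hP : 0 < (5 + 2 * α + 2 * (C * 2 ^ d) ^ (q - 1)) * (C * 2 ^ d) := by positivity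
  have hQ : 0 < (1 + (α + C ^ (q - 1)) * C) ^ (1 / (p - 1)) := by positivity
  rcases le_total r 1 with hr1 | hr1
  · have hbase : |derivWithin w (Ici 0) r| ≤ (1 + (α + C ^ (q - 1)) * C) ^ (1 / (p - 1)) := by
      rcases hr.eq_or_lt with rfl | hr0
      · rw [h0, abs_zero]
        exact hQ.le
      have hcont := hv.continuousOn 0 (by simp)
      have hev : ∀ᶠ s in 𝓝[>] (0 : ℝ), |phiP p (derivWithin w (Ici 0) s)| < 1 := by
        have ht := (hcont.mono Ioi_subset_Ici_self).tendsto.abs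
        simp only [h0, phiP_zero, abs_zero] at ht
        exact ht.eventually_lt_const one_pos
      obtain ⟨b, hb1, hb⟩ := (hev.and (Ioo_mem_nhdsGT hr0)).exists
      refine SolvesAt.abs_le_near_zero hN hp hq hα hb.1 hb.2.le hr1 hC
        (fun s hs => hsol s (hb.1.trans_le hs.1)) (fun s hs => ?_) hb1.le
      have hs0 : 0 < s := hb.1.trans_le hs.1
      refine (hw s hs0.le).trans ?_
      have : (1 + s) ^ (-d) ≤ 1 := Real.rpow_le_one_of_one_le_of_nonpos (by linarith) (by linarith)
      nlinarith
    have h1 : 1 ≤ 2 ^ (d + 1) * (1 + r) ^ (-d - 1) := by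
      have := rpow_neg_half_le (d := d + 1) (x := 1 + r) (y := 1) (by linarith) (by linarith)
        (by linarith)
      rwa [Real.one_rpow, neg_add'] at this
    calc _ ≤ _ := hbase
      _ ≤ (1 + (α + C ^ (q - 1)) * C) ^ (1 / (p - 1)) * (2 ^ (d + 1) * (1 + r) ^ (-d - 1)) :=
          le_mul_of_one_le_right hQ.le h1
      _ ≤ _ := by
          rw [gradBound, ← mul_assoc]
          gcongr
          linarith
  · have hr0 : 0 < r := by linarith
    have hle1 : (1 + r) ^ (-d) ≤ 1 :=
      Real.rpow_le_one_of_one_le_of_nonpos (by linarith) (by linarith)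
    have hC2 : 0 < C * 2 ^ d := by positivity
    have hmain := SolvesAt.abs_le_of_bound hN hp hq hα (D := C * 2 ^ d * (1 + r) ^ (-d))
      (C := C * 2 ^ d) hr0 (by positivity) (mul_le_of_le_one_right hC2.le hle1)
      (fun s hs => hsol s (by linarith [hs.1])) (fun s hs => ?_)
    · have hinv : 1 / r ≤ 2 * (1 + r)⁻¹ := by
        rw [← div_eq_mul_inv, div_le_div_iff₀ hr0 (by linarith)]
        linarith
      have hsplit : (1 + r) ^ (-d - 1) = (1 + r) ^ (-d) * (1 + r)⁻¹ := by
        rw [Real.rpow_sub_one (by positivity), div_eq_mul_inv]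
      refine hmain.trans ?_
      calc _ = (5 + 2 * α + 2 * (C * 2 ^ d) ^ (q - 1)) * (C * 2 ^ d) * (1 + r) ^ (-d) *
            (1 / r) := by ring
        _ ≤ (5 + 2 * α + 2 * (C * 2 ^ d) ^ (q - 1)) * (C * 2 ^ d) * (1 + r) ^ (-d) *
            (2 * (1 + r)⁻¹) := by gcongr
        _ = 2 * ((5 + 2 * α + 2 * (C * 2 ^ d) ^ (q - 1)) * (C * 2 ^ d)) *
            (1 + r) ^ (-d - 1) := by rw [hsplit]; ring
        _ ≤ _ := by
            rw [gradBound]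
            gcongr
            exact le_add_of_nonneg_right (by positivity)
    · have hs0 : 0 ≤ s := by linarith [hs.1]
      refine (hw s hs0).trans ?_
      rw [mul_assoc]
      gcongr
      exact rpow_neg_half_le hd (by linarith) (by linarith [hs.1])

lemma IsSolutionOn.derivWithin_isBigO {N : ℕ} (hN : 1 ≤ N) {p q α : ℝ} (hp : 1 < p)
    (hq : 1 < q) (hα : 0 < α) {d : ℝ} (hd : 0 ≤ d) {r₀ : ℝ} {w : ℝ → ℝ}
    (hs : IsSolutionOn N p q α w (Ici r₀)) (hw : w =O[atTop] fun r : ℝ => r ^ (-d)) :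
    (fun r => derivWithin w (Ici r₀) r) =O[atTop] fun r : ℝ => r ^ (-d - 1) := by
  obtain ⟨hc, hv, he⟩ := hs
  obtain ⟨C, hC, hbound⟩ := hw.exists_pos
  obtain ⟨R, hR⟩ := eventually_atTop.1 hbound.bound
  refine IsBigO.of_bound ((5 + 2 * α + 2 * (C * 2 ^ d) ^ (q - 1)) * (C * 2 ^ d)) ?_
  filter_upwards [eventually_ge_atTop 1, eventually_ge_atTop (2 * R),
    eventually_gt_atTop (2 * r₀)] with r hr1 hrR hrr
  have hr0 : 0 < r := by linarith
  have hC2 : 0 < C * 2 ^ d := by positivity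
  have hle1 : r ^ (-d) ≤ 1 := Real.rpow_le_one_of_one_le_of_nonpos hr1 (by linarith)
  have hmain := SolvesAt.abs_le_of_bound (N := N) (p := p) (q := q) (α := α) (w := w)
    (g := derivWithin w (Ici r₀)) hN hp hq hα (D := C * 2 ^ d * r ^ (-d))
    (C := C * 2 ^ d) hr0 (by positivity) (mul_le_of_le_one_right hC2.le hle1)
    (fun s hs => ?_) (fun s hs => ?_)
  · rw [Real.norm_eq_abs, Real.norm_eq_abs, abs_of_pos (by positivity : 0 < r ^ (-d - 1)),
      Real.rpow_sub_one hr0.ne']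
    refine hmain.trans (le_of_eq ?_)
    ring
  · have : r₀ < s := by linarith [hs.1]
    exact SolvesAt.of_derivWithin this hc hv (he s this.le)
  · have hs0 : 0 < s := by linarith [hs.1]
    have := hR s (by linarith [hs.1])
    rw [Real.norm_eq_abs, Real.norm_eq_abs, abs_of_pos (by positivity : 0 < s ^ (-d))] at this
    refine this.trans ?_
    rw [mul_assoc]
    gcongr
    exact rpow_neg_half_le hd hr0 hs.1

/-- Let `d ≥ 0`. (i) If a global solution `w` of (E) satisfies
`|w(r)| ≤ C_d (1+r)^{-d}` on `[0,∞)`, then `|w'(r)| ≤ C'_d (1+r)^{-d-1}` where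
`C'_d` depends continuously on `C_d`. (ii) For any solution on `[r₀,∞)`,
`w(r) = O(r^{-d})` implies `w'(r) = O(r^{-d-1})` as `r → ∞`. -/
theorem stmt6 (N : ℕ) (hN : 1 ≤ N) (p q α : ℝ) (hp : 1 < p) (hq : 1 < q) (hα : 0 < α)
    (d : ℝ) (hd : 0 ≤ d) :
    (∃ F : ℝ → ℝ, ContinuousOn F (Ioi 0) ∧
      ∀ C : ℝ, 0 < C → 0 < F C ∧
        ∀ a : ℝ, ∀ w : ℝ → ℝ, IsGlobalSolution N p q α a w →
          (∀ r ∈ Ici (0 : ℝ), |w r| ≤ C * (1 + r) ^ (-d)) →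
          ∀ r ∈ Ici (0 : ℝ), |derivWithin w (Ici 0) r| ≤ F C * (1 + r) ^ (-d - 1)) ∧
    (∀ r₀ : ℝ, 0 < r₀ → ∀ w : ℝ → ℝ, IsSolutionOn N p q α w (Ici r₀) →
      (w =O[atTop] fun r : ℝ => r ^ (-d)) →
      (fun r => derivWithin w (Ici r₀) r) =O[atTop] fun r : ℝ => r ^ (-d - 1)) := by
  refine ⟨⟨gradBound p q α d, continuousOn_gradBound hα, fun C hC => ⟨?_, ?_⟩⟩, ?_⟩
  · unfold gradBound
    positivity
  · intro a w hs hw r hr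
    exact hs.abs_derivWithin_le hN hp hq hα hd hC hw hr
  · intro r₀ _ w hs hw
    exact hs.derivWithin_isBigO hN hp hq hα hd hw
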